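/- arXiv:0711.4929 — 2 statements merged into one kernel-verified Lean document; each statement's English description precedes it below -/
import Mathlib

section
/- For every integer n ≥ 2, the quotient ring ℚ[ξ,α,ρ]/⟨P₁,P₂,P₃⟩ is a finite-dimensional ℚ-vector space of dimension (n−1)·n·(n+1). -/
open MvPolynomial

/-- The variable `ξ` of `ℚ[ξ,α,ρ]`. -/
noncomputable def xiVar : MvPolynomial (Fin 3) ℚ := X 0
/-- The variable `α` of `ℚ[ξ,α,ρ]`. -/
noncomputable def alVar : MvPolynomial (Fin 3) ℚ := X 1
/-- The variable `ρ` of `ℚ[ξ,α,ρ]`. -/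
noncomputable def rhVar : MvPolynomial (Fin 3) ℚ := X 2

/-- `P₁ = ∑_{k=1}^{n} (n choose k)·ξ^{n−k}·((ρ+2α)^{k−1} + (ρ−2α)^{k−1})`. -/
noncomputable def P1 (n : ℕ) : MvPolynomial (Fin 3) ℚ :=
  ∑ k ∈ Finset.Icc 1 n, (n.choose k : MvPolynomial (Fin 3) ℚ) * xiVar ^ (n - k) *
    ((rhVar + 2 * alVar) ^ (k - 1) + (rhVar - 2 * alVar) ^ (k - 1))

/-- `P₂ = (ρ+2α+ξ)^n + (ρ−2α+ξ)^n`. -/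
noncomputable def P2 (n : ℕ) : MvPolynomial (Fin 3) ℚ :=
  (rhVar + 2 * alVar + xiVar) ^ n + (rhVar - 2 * alVar + xiVar) ^ n

/-- `P₃ = ξ^n·ρ`. -/
noncomputable def P3 (n : ℕ) : MvPolynomial (Fin 3) ℚ := xiVar ^ n * rhVar

abbrev RR := MvPolynomial (Fin 3) ℚ

noncomputable def ad (I : Ideal RR) (a : RR) : Ideal RR := Ideal.span {a} ⊔ I

def Nzd (I : Ideal RR) (a : RR) : Prop := ∀ x, a * x ∈ I → x ∈ I

noncomputable def len (I : Ideal RR) : ℕ∞ := Module.length ℚ (RR ⧸ I)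

lemma mem_ad {I : Ideal RR} {a x : RR} : x ∈ ad I a ↔ ∃ c, ∃ b ∈ I, c * a + b = x :=
  Ideal.mem_span_singleton_sup

lemma le_ad (I : Ideal RR) (a : RR) : I ≤ ad I a := le_sup_right

lemma self_ad (I : Ideal RR) (a : RR) : a ∈ ad I a :=
  mem_ad.2 ⟨1, 0, I.zero_mem, by ring⟩

lemma ad_le {I K : Ideal RR} {a : RR} (h : I ≤ K) (ha : a ∈ K) : ad I a ≤ K :=
  sup_le ((Ideal.span_singleton_le_iff_mem K).2 ha) h

lemma ad_comm (I : Ideal RR) (a b : RR) : ad (ad I a) b = ad (ad I b) a :=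
  sup_left_comm _ _ _

lemma ad_congr {J : Ideal RR} {x y : RR} (c d : RR) (h1 : c * x - y ∈ J) (h2 : d * y - x ∈ J) :
    ad J x = ad J y := by
  apply le_antisymm
  · exact ad_le (le_ad _ _) (mem_ad.2 ⟨d, -(d * y - x), J.neg_mem h2, by ring⟩)
  · exact ad_le (le_ad _ _) (mem_ad.2 ⟨c, -(c * x - y), J.neg_mem h1, by ring⟩)

lemma Nzd.mul {I : Ideal RR} {a b : RR} (ha : Nzd I a) (hb : Nzd I b) : Nzd I (a * b) :=
  fun x hx => hb _ (ha _ (by rwa [mul_assoc] at hx))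

lemma Nzd.pow {I : Ideal RR} {a : RR} (ha : Nzd I a) (k : ℕ) : Nzd I (a ^ k) := by
  induction k with
  | zero => intro x hx; simpa using hx
  | succ k ih => rw [pow_succ]; exact ih.mul ha

lemma Nzd.congr {I : Ideal RR} {a b : RR} (c : RR) (ha : Nzd I a) (h : c * b - a ∈ I) :
    Nzd I b := by
  intro x hx
  apply ha
  have := I.sub_mem (I.mul_mem_left c hx) (I.mul_mem_right x h)
  convert this using 1
  ring

lemma Nzd.perm {J : Ideal RR} {x y : RR} (hx : Nzd J x) (hy : Nzd (ad J x) y) :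
    Nzd (ad J y) x := by
  intro w hw
  obtain ⟨c, j, hj, h⟩ := mem_ad.1 hw
  have : c ∈ ad J x := hy _ (mem_ad.2 ⟨w, -j, J.neg_mem hj, by linear_combination -h⟩)
  obtain ⟨c', j', hj', rfl⟩ := mem_ad.1 this
  have h3 : w - y * c' ∈ J := by
    apply hx
    have : x * (w - y * c') = j' * y + j := by linear_combination -h
    rw [this]
    exact J.add_mem (J.mul_mem_right _ hj') hj
  exact mem_ad.2 ⟨c', _, h3, by ring⟩

lemma len_mul {I : Ideal RR} {a : RR} (b : RR) (ha : Nzd I a) :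
    len (ad I (a * b)) = len (ad I b) + len (ad I a) := by
  have hle : ad I b ≤ Submodule.comap (LinearMap.mulLeft RR a) (ad I (a * b)) := by
    intro x hx
    obtain ⟨c, j, hj, rfl⟩ := mem_ad.1 hx
    exact mem_ad.2 ⟨c, a * j, I.mul_mem_left _ hj, by simp only [LinearMap.mulLeft_apply]; ring⟩
  have hle2 : ad I (a * b) ≤ ad I a :=
    ad_le (le_ad _ _) ((ad I a).mul_mem_right _ (self_ad _ _))
  let f : (RR ⧸ ad I b) →ₗ[RR] (RR ⧸ ad I (a * b)) :=
    Submodule.mapQ _ _ (LinearMap.mulLeft RR a) hle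
  let g : (RR ⧸ ad I (a * b)) →ₗ[RR] (RR ⧸ ad I a) :=
    Submodule.factor hle2
  refine Module.length_eq_add_of_exact (f.restrictScalars ℚ) (g.restrictScalars ℚ) ?_ ?_ ?_
  · change Function.Injective f
    rw [injective_iff_map_eq_zero]
    intro z hz
    obtain ⟨x, rfl⟩ := Submodule.Quotient.mk_surjective _ z
    rw [Submodule.mapQ_apply, Submodule.Quotient.mk_eq_zero] at hz
    rw [Submodule.Quotient.mk_eq_zero]
    obtain ⟨c, j, hj, h⟩ := mem_ad.1 hz
    simp only [LinearMap.mulLeft_apply] at h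
    have : x - c * b ∈ I := ha _ (by
      have : a * (x - c * b) = j := by linear_combination -h
      rwa [this])
    exact mem_ad.2 ⟨c, _, this, by ring⟩
  · change Function.Surjective g
    exact Submodule.factor_surjective hle2
  · change Function.Exact f g
    intro z
    obtain ⟨x, rfl⟩ := Submodule.Quotient.mk_surjective _ z
    constructor
    · intro hz
      have hz : x ∈ ad I a := (Submodule.Quotient.mk_eq_zero _).1 hz
      obtain ⟨c, j, hj, h⟩ := mem_ad.1 hz
      refine ⟨Submodule.Quotient.mk c, ?_⟩
      rw [Submodule.mapQ_apply, Submodule.Quotient.eq]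
      refine le_ad _ _ ?_
      have : (LinearMap.mulLeft RR a) c - x = -j := by
        simp only [LinearMap.mulLeft_apply]; linear_combination h
      rw [this]
      exact I.neg_mem hj
    · rintro ⟨w, hw⟩
      obtain ⟨y, rfl⟩ := Submodule.Quotient.mk_surjective _ w
      rw [← hw]
      refine (Submodule.Quotient.mk_eq_zero _).2 ?_
      exact (ad I a).mul_mem_right _ (self_ad _ _)

lemma len_pow_mul {I : Ideal RR} {a : RR} (b : RR) (ha : Nzd I a) (k : ℕ) :
    len (ad I (a ^ k * b)) = k * len (ad I a) + len (ad I b) := by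
  induction k with
  | zero => simp
  | succ k ih =>
    rw [show a ^ (k + 1) * b = a * (a ^ k * b) by ring, len_mul _ ha, ih]
    push_cast
    ring

lemma len_top : len ⊤ = 0 := by
  unfold len
  rw [Module.length_eq_zero_iff]
  exact Ideal.Quotient.subsingleton_iff.2 rfl

lemma len_pow {I : Ideal RR} {a : RR} (ha : Nzd I a) (k : ℕ) :
    len (ad I (a ^ k)) = k * len (ad I a) := by
  have h := len_pow_mul 1 ha k
  have : ad I 1 = ⊤ := (Ideal.eq_top_iff_one _).2 (self_ad _ _)
  rwa [this, len_top, mul_one, add_zero] at h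

lemma retr {I : Ideal RR} (f : Fin 3 → RR) (h1 : ∀ i, X i - f i ∈ I)
    (h2 : I ≤ RingHom.ker (aeval f : RR →ₐ[ℚ] RR)) (p : RR) : p ∈ I ↔ aeval f p = 0 := by
  refine ⟨fun h => h2 h, fun h => ?_⟩
  have key : (Ideal.Quotient.mkₐ ℚ I).comp (aeval f : RR →ₐ[ℚ] RR) = Ideal.Quotient.mkₐ ℚ I := by
    apply MvPolynomial.algHom_ext
    intro i
    simp only [AlgHom.comp_apply, aeval_X, Ideal.Quotient.mkₐ_eq_mk]
    exact ((Ideal.Quotient.mk_eq_mk_iff_sub_mem _ _).2 (h1 i)).symm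
  have := DFunLike.congr_fun key p
  rw [AlgHom.comp_apply, h, map_zero] at this
  exact Ideal.Quotient.eq_zero_iff_mem.1 this.symm

lemma nzd_of_retr {I : Ideal RR} {f : Fin 3 → RR} (h : ∀ p, p ∈ I ↔ aeval f p = 0) {a : RR}
    (ha : aeval f a ≠ 0) : Nzd I a := by
  intro x hx
  rw [h] at hx ⊢
  rw [map_mul] at hx
  exact (mul_eq_zero.1 hx).resolve_left ha

lemma len_one {I : Ideal RR} (h1 : ∀ i, X i ∈ I)
    (h2 : I ≤ RingHom.ker (aeval (fun _ => 0) : RR →ₐ[ℚ] RR)) : len I = 1 := by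
  have h := retr (I := I) (fun _ => 0) (by simpa using h1) h2
  have hI : I = RingHom.ker (aeval (fun _ => 0) : RR →ₐ[ℚ] ℚ) := by
    ext p
    rw [h, RingHom.mem_ker]
    have : (aeval (fun _ => 0) p : RR) = C (aeval (fun _ => (0 : ℚ)) p) := by
      have := DFunLike.congr_fun (MvPolynomial.algHom_ext (R := ℚ) (f := (aeval (fun _ => 0) : RR →ₐ[ℚ] RR))
        (g := (Algebra.ofId ℚ RR).comp (aeval (fun _ => 0) : RR →ₐ[ℚ] ℚ)) (by intro i; rw [AlgHom.comp_apply, aeval_X, aeval_X, map_zero])) p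
      exact this
    rw [this]
    simp
  have e := Ideal.quotientKerAlgEquivOfSurjective (R₁ := ℚ)
    (f := (aeval (fun _ => 0) : RR →ₐ[ℚ] ℚ)) (fun q => ⟨C q, by simp⟩)
  unfold len
  rw [hI, e.toLinearEquiv.length_eq, Module.length_eq_finrank]
  simp

@[simp]
lemma b2 (f : Fin 3 → RR) : bind₁ f (2 : RR) = 2 := map_ofNat _ _

noncomputable abbrev uu : RR := rhVar + 2 * alVar
noncomputable abbrev vv : RR := rhVar - 2 * alVar
noncomputable abbrev ss : RR := xiVar + 2 * alVar
noncomputable abbrev tt : RR := xiVar - 2 * alVar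

noncomputable def Jx : Ideal RR := ad ⊥ xiVar
noncomputable def Jr : Ideal RR := ad ⊥ rhVar

lemma mJx (p : RR) : p ∈ Jx ↔ aeval ![0, alVar, rhVar] p = 0 := by
  refine retr _ ?_ ?_ p
  · intro i
    fin_cases i
    · simpa [xiVar, Jx] using self_ad ⊥ xiVar
    · simp [alVar]
    · simp [rhVar]
  · refine ad_le bot_le ?_
    simp [RingHom.mem_ker, xiVar]

lemma mJr (p : RR) : p ∈ Jr ↔ aeval ![xiVar, alVar, 0] p = 0 := by
  refine retr _ ?_ ?_ p
  · intro i
    fin_cases i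
    · simp [xiVar]
    · simp [alVar]
    · simpa [rhVar, Jr] using self_ad ⊥ rhVar
  · refine ad_le bot_le ?_
    simp [RingHom.mem_ker, rhVar]

lemma xi_Jx : xiVar ∈ Jx := self_ad _ _
lemma rh_Jr : rhVar ∈ Jr := self_ad _ _

lemma mA (p : RR) : p ∈ ad Jx uu ↔ aeval ![0, alVar, -2 * alVar] p = 0 := by
  refine retr _ ?_ ?_ p
  · intro i
    fin_cases i
    · simpa [xiVar] using le_ad Jx uu xi_Jx
    · simp [alVar]
    · simpa [rhVar, alVar, uu] using self_ad Jx uu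
  · refine ad_le (ad_le bot_le ?_) ?_
    · simp [RingHom.mem_ker, xiVar]
    · simp [RingHom.mem_ker, rhVar, alVar]

lemma mB (p : RR) : p ∈ ad Jx alVar ↔ aeval ![0, 0, rhVar] p = 0 := by
  refine retr _ ?_ ?_ p
  · intro i
    fin_cases i
    · simpa [xiVar] using le_ad Jx alVar xi_Jx
    · simpa [alVar] using self_ad Jx alVar
    · simp [rhVar]
  · refine ad_le (ad_le bot_le ?_) ?_
    · simp [RingHom.mem_ker, xiVar]
    · simp [RingHom.mem_ker, alVar]

lemma mC (p : RR) : p ∈ ad Jr ss ↔ aeval ![-2 * alVar, alVar, 0] p = 0 := by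
  refine retr _ ?_ ?_ p
  · intro i
    fin_cases i
    · simpa [xiVar, alVar, ss] using self_ad Jr ss
    · simp [alVar]
    · simpa [rhVar] using le_ad Jr ss rh_Jr
  · refine ad_le (ad_le bot_le ?_) ?_
    · simp [RingHom.mem_ker, rhVar]
    · simp [RingHom.mem_ker, xiVar, alVar]

lemma nz_of_eval {p : RR} (g : Fin 3 → ℚ) (h : eval g p ≠ 0) : p ≠ 0 := by
  rintro rfl
  simp at h

lemma nA : Nzd (ad Jx uu) vv := by
  refine nzd_of_retr mA (nz_of_eval (fun _ => 1) ?_)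
  simp [rhVar, alVar]; norm_num

lemma nB : Nzd (ad Jx alVar) vv := by
  refine nzd_of_retr mB (nz_of_eval (fun _ => 1) ?_)
  simp [rhVar, alVar]

lemma nC : Nzd (ad Jr ss) tt := by
  refine nzd_of_retr mC (nz_of_eval (fun _ => 1) ?_)
  simp [xiVar, alVar]; norm_num

lemma c_mem {I : Ideal RR} (q : ℚ) {a p : RR} (ha : a ∈ I) (h : C q * a = p) : p ∈ I :=
  h ▸ I.mul_mem_left _ ha

lemma Chalf : (C (1/2) : RR) * 2 = 1 := by
  rw [show (2 : RR) = C 2 from (map_ofNat C 2).symm, ← C_mul]; norm_num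
lemma Cquarter : (C (1/4) : RR) * 4 = 1 := by
  rw [show (4 : RR) = C 4 from (map_ofNat C 4).symm, ← C_mul]; norm_num

lemma lenA : len (ad (ad Jx uu) vv) = 1 := by
  have hx : xiVar ∈ ad (ad Jx uu) vv := le_ad _ _ (le_ad _ _ xi_Jx)
  have hu : uu ∈ ad (ad Jx uu) vv := le_ad _ _ (self_ad _ _)
  have hv : vv ∈ ad (ad Jx uu) vv := self_ad _ _
  apply len_one
  · intro i
    fin_cases i
    · exact hx
    · exact c_mem (1/4) (Ideal.sub_mem _ hu hv) (by
        change _ = alVar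
        linear_combination alVar * Cquarter)
    · exact c_mem (1/2) (Ideal.add_mem _ hu hv) (by
        change _ = rhVar
        linear_combination rhVar * Chalf)
  · refine ad_le (ad_le (ad_le bot_le ?_) ?_) ?_ <;>
      simp [RingHom.mem_ker, xiVar, rhVar, alVar]

lemma lenB : len (ad (ad Jx alVar) vv) = 1 := by
  have hx : xiVar ∈ ad (ad Jx alVar) vv := le_ad _ _ (le_ad _ _ xi_Jx)
  have hu : alVar ∈ ad (ad Jx alVar) vv := le_ad _ _ (self_ad _ _)
  have hv : vv ∈ ad (ad Jx alVar) vv := self_ad _ _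
  apply len_one
  · intro i
    fin_cases i
    · exact hx
    · exact hu
    · have := Ideal.add_mem _ hv (Ideal.mul_mem_left _ 2 hu)
      rwa [sub_add_cancel] at this
  · refine ad_le (ad_le (ad_le bot_le ?_) ?_) ?_ <;>
      simp [RingHom.mem_ker, xiVar, rhVar, alVar]

lemma lenC : len (ad (ad Jr ss) tt) = 1 := by
  have hx : rhVar ∈ ad (ad Jr ss) tt := le_ad _ _ (le_ad _ _ rh_Jr)
  have hu : ss ∈ ad (ad Jr ss) tt := le_ad _ _ (self_ad _ _)
  have hv : tt ∈ ad (ad Jr ss) tt := self_ad _ _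
  apply len_one
  · intro i
    fin_cases i
    · exact c_mem (1/2) (Ideal.add_mem _ hu hv) (by
        change _ = xiVar
        linear_combination xiVar * Chalf)
    · exact c_mem (1/4) (Ideal.sub_mem _ hu hv) (by
        change _ = alVar
        linear_combination alVar * Cquarter)
    · exact hx
  · refine ad_le (ad_le (ad_le bot_le ?_) ?_) ?_ <;>
      simp [RingHom.mem_ker, xiVar, rhVar, alVar]

noncomputable def QQ (m : ℕ) : RR := uu ^ m + vv ^ m

-- reductions mod xi
lemma P1_red (m : ℕ) : P1 (m + 1) - QQ m ∈ Jx := by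
  rw [mJx, map_sub, sub_eq_zero]
  unfold P1
  rw [Finset.sum_Icc_succ_top (by omega), map_add, map_sum, Finset.sum_eq_zero]
  · simp [QQ, xiVar, alVar, rhVar]
  · intro k hk
    have : m + 1 - k ≠ 0 := by have := Finset.mem_Icc.1 hk; omega
    simp [xiVar, this]

lemma P2_red (m : ℕ) : P2 (m + 1) - (uu ^ (m + 1) + vv ^ (m + 1)) ∈ Jx := by
  rw [mJx]
  simp [P2, xiVar, alVar, rhVar]

lemma P2_red2 (m : ℕ) : P2 (m + 1) - 4 * (uu ^ m * alVar) ∈ ad Jx (QQ m) := by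
  refine mem_ad.2 ⟨vv, _, P2_red m, ?_⟩
  unfold QQ uu vv
  ring

lemma QA (m : ℕ) (hm : 1 ≤ m) : QQ m - vv ^ m ∈ ad Jx uu := by
  have : QQ m - vv ^ m = uu * uu ^ (m - 1) := by
    rw [← pow_succ', Nat.sub_add_cancel hm]; unfold QQ; ring
  rw [this]
  exact Ideal.mul_mem_right _ _ (self_ad _ _)

lemma QB (m : ℕ) : QQ m - 2 * vv ^ m ∈ ad Jx alVar := by
  rw [mB]
  simp [QQ, alVar, rhVar]
  ring

lemma QB' (m : ℕ) : C (1/2) * QQ m - vv ^ m ∈ ad Jx alVar := by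
  refine c_mem (1/2) (QB m) ?_
  linear_combination -vv ^ m * Chalf

lemma n_u_Jx : Nzd Jx uu := by
  refine nzd_of_retr mJx (nz_of_eval (fun _ => 1) ?_)
  simp [rhVar, alVar]; norm_num
lemma n_al_Jx : Nzd Jx alVar := by
  refine nzd_of_retr mJx (nz_of_eval (fun _ => 1) ?_)
  simp [alVar]
lemma n_Q_Jx (m : ℕ) : Nzd Jx (QQ m) := by
  refine nzd_of_retr mJx (nz_of_eval ![0, 0, 1] ?_)
  simp [QQ, rhVar, alVar]

lemma n_u (m : ℕ) (hm : 1 ≤ m) : Nzd (ad Jx (QQ m)) uu :=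
  n_u_Jx.perm ((nA.pow m).congr 1 (by simpa using QA m hm))

lemma n_al (m : ℕ) : Nzd (ad Jx (QQ m)) alVar :=
  n_al_Jx.perm ((nB.pow m).congr _ (QB' m))

lemma len_xi (m : ℕ) (hm : 1 ≤ m) : len (ad (ad Jx (QQ m)) (uu ^ m * alVar)) = m * m + m := by
  rw [len_pow_mul _ (n_u m hm), ad_comm Jx (QQ m) uu, ad_comm Jx (QQ m) alVar,
    ad_congr (J := ad Jx uu) (x := QQ m) (y := vv ^ m) 1 1 (by simpa using QA m hm)
      (by rw [one_mul, ← neg_sub]; exact neg_mem (QA m hm)),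
    ad_congr (J := ad Jx alVar) (x := QQ m) (y := vv ^ m) _ 2 (QB' m)
      (by rw [← neg_sub]; exact neg_mem (QB m)),
    len_pow nA, len_pow nB, lenA, lenB]
  simp

noncomputable def II (m : ℕ) : Ideal RR := ad (ad ⊥ (P1 (m + 1))) (P2 (m + 1))

lemma Jx_P1 (m : ℕ) : ad Jx (P1 (m + 1)) = ad Jx (QQ m) :=
  ad_congr 1 1 (by simpa using P1_red m)
    (by rw [one_mul, ← neg_sub]; exact neg_mem (P1_red m))

lemma P2_red3 (m : ℕ) :
    C (1/4) * P2 (m + 1) - uu ^ m * alVar ∈ ad Jx (QQ m) := by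
  refine c_mem (1/4) (P2_red2 m) ?_
  linear_combination -(uu ^ m * alVar) * Cquarter

lemma II_xi (m : ℕ) : ad (II m) xiVar = ad (ad Jx (QQ m)) (uu ^ m * alVar) := by
  unfold II
  rw [ad_comm, ad_comm ⊥]
  change ad (ad Jx _) _ = _
  rw [Jx_P1]
  exact ad_congr _ 4 (P2_red3 m) (by rw [← neg_sub]; exact neg_mem (P2_red2 m))

lemma nzd_bot {a : RR} (h : a ≠ 0) : Nzd ⊥ a := by
  intro x hx
  rw [Ideal.mem_bot] at hx ⊢
  exact (mul_eq_zero.1 hx).resolve_left h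

lemma n_xi (m : ℕ) (hm : 1 ≤ m) : Nzd (II m) xiVar := by
  apply Nzd.perm
  · apply Nzd.perm (nzd_bot (X_ne_zero _))
    exact (n_Q_Jx m).congr 1 (by rw [one_mul]; exact P1_red m)
  · rw [ad_comm]
    change Nzd (ad Jx _) _
    rw [Jx_P1]
    exact (((n_u m hm).pow m).mul (n_al m)).congr _ (P2_red3 m)

-- the rho part
noncomputable def hh (m : ℕ) : RR := ∑ i ∈ Finset.range (m + 1), ss ^ i * tt ^ (m - i)

lemma hh_mul (m : ℕ) : 4 * alVar * hh m = ss ^ (m + 1) - tt ^ (m + 1) := by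
  have := (Commute.all ss tt).mul_geom_sum₂ (m + 1)
  rw [← this]
  unfold hh
  congr 1
  unfold ss tt
  ring

lemma binom_aux (x w : RR) (n : ℕ) :
    w * ∑ k ∈ Finset.Icc 1 n, (n.choose k : RR) * x ^ (n - k) * w ^ (k - 1) =
      (x + w) ^ n - x ^ n := by
  rw [add_comm x w, add_pow, Finset.sum_range_succ', Finset.mul_sum]
  simp only [pow_zero, one_mul, Nat.sub_zero, Nat.choose_zero_right, Nat.cast_one, mul_one,
    add_sub_cancel_right]
  rw [Finset.range_eq_Ico, Finset.sum_Ico_add' (fun k => w ^ k * x ^ (n - k) * (n.choose k : RR)) 0 n 1]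
  refine Finset.sum_congr (by ext; simp) ?_
  intro k hk
  have : 1 ≤ k := (Finset.mem_Icc.1 hk).1
  obtain ⟨j, rfl⟩ := Nat.exists_eq_add_of_le' this
  simp
  ring

lemma P1_rho (m : ℕ) : P1 (m + 1) - 2 * hh m ∈ Jr := by
  rw [mJr, map_sub, sub_eq_zero]
  have ha : (4 * alVar : RR) ≠ 0 := nz_of_eval (fun _ => 1) (by simp [alVar])
  have h1 := binom_aux xiVar (2 * alVar) (m + 1)
  have h2 := binom_aux xiVar (-(2 * alVar)) (m + 1)
  have h3 := hh_mul m
  have hhh : aeval ![xiVar, alVar, 0] (2 * hh m) = 2 * hh m := by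
    simp [hh, ss, tt, xiVar, alVar]
  have hP : aeval ![xiVar, alVar, 0] (P1 (m + 1)) =
      ∑ k ∈ Finset.Icc 1 (m + 1), ((m + 1).choose k : RR) * xiVar ^ (m + 1 - k) * (2 * alVar) ^ (k - 1)
      + ∑ k ∈ Finset.Icc 1 (m + 1), ((m + 1).choose k : RR) * xiVar ^ (m + 1 - k) *
        (-(2 * alVar)) ^ (k - 1) := by
    rw [← Finset.sum_add_distrib, P1, map_sum]
    refine Finset.sum_congr rfl fun k _ => ?_
    simp [xiVar, alVar, rhVar, mul_add]
  rw [hhh, hP]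
  apply mul_left_cancel₀ ha
  rw [← sub_eq_add_neg] at h2
  linear_combination 2 * h1 - 2 * h2 - 2 * h3

lemma P1_rho' (m : ℕ) : C (1/2) * P1 (m + 1) - hh m ∈ Jr := by
  refine c_mem (1/2) (P1_rho m) ?_
  linear_combination -hh m * Chalf

lemma Jr_P1 (m : ℕ) : ad Jr (P1 (m + 1)) = ad Jr (hh m) :=
  ad_congr _ 2 (P1_rho' m) (by rw [← neg_sub]; exact neg_mem (P1_rho m))

lemma P2_rho (m : ℕ) : P2 (m + 1) - 2 * ss ^ (m + 1) ∈ ad Jr (hh m) := by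
  refine mem_ad.2 ⟨-(4 * alVar), P2 (m + 1) - (ss ^ (m + 1) + tt ^ (m + 1)), ?_, ?_⟩
  · rw [mJr]
    simp [P2, xiVar, alVar, rhVar]
    ring
  · linear_combination -hh_mul m

lemma P2_rho' (m : ℕ) : C (1/2) * P2 (m + 1) - ss ^ (m + 1) ∈ ad Jr (hh m) := by
  refine c_mem (1/2) (P2_rho m) ?_
  linear_combination -ss ^ (m + 1) * Chalf

lemma II_rho (m : ℕ) : ad (II m) rhVar = ad (ad Jr (hh m)) (ss ^ (m + 1)) := by
  unfold II
  rw [ad_comm, ad_comm ⊥]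
  change ad (ad Jr _) _ = _
  rw [Jr_P1]
  exact ad_congr _ 2 (P2_rho' m) (by rw [← neg_sub]; exact neg_mem (P2_rho m))

lemma hC (m : ℕ) : hh m - tt ^ m ∈ ad Jr ss := by
  unfold hh
  rw [Finset.sum_range_succ']
  simp only [pow_zero, one_mul, Nat.sub_zero, add_sub_cancel_right]
  refine Ideal.sum_mem _ fun i _ => ?_
  rw [pow_succ', mul_assoc]
  exact Ideal.mul_mem_right _ _ (self_ad _ _)

lemma n_s (m : ℕ) : Nzd (ad Jr (hh m)) ss := by
  refine Nzd.perm ?_ ((nC.pow m).congr 1 (by simpa using hC m))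
  refine nzd_of_retr mJr (nz_of_eval (fun _ => 1) ?_)
  simp [xiVar, alVar]; norm_num

lemma len_rho (m : ℕ) : len (ad (II m) rhVar) = (m + 1 : ℕ) * m := by
  rw [II_rho, len_pow (n_s m), ad_comm,
    ad_congr (J := ad Jr ss) (x := hh m) (y := tt ^ m) 1 1 (by simpa using hC m)
      (by rw [one_mul, ← neg_sub]; exact neg_mem (hC m)), len_pow nC, lenC, mul_one]

lemma span_eq (m : ℕ) : Ideal.span ({P1 (m + 1), P2 (m + 1), P3 (m + 1)} : Set RR) =
    ad (II m) (xiVar ^ (m + 1) * rhVar) := by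
  unfold II ad P3
  rw [Ideal.span_insert, Ideal.span_insert, sup_bot_eq]
  generalize Ideal.span {P1 (m + 1)} = a
  generalize Ideal.span {P2 (m + 1)} = b
  generalize Ideal.span {xiVar ^ (m + 1) * rhVar} = c
  ac_rfl

lemma len_main (m : ℕ) (hm : 1 ≤ m) :
    len (Ideal.span ({P1 (m + 1), P2 (m + 1), P3 (m + 1)} : Set RR)) =
      ((m * (m + 1) * (m + 1 + 1) : ℕ) : ℕ∞) := by
  rw [span_eq, len_pow_mul _ (n_xi m hm), len_rho, II_xi, len_xi m hm]
  push_cast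
  ring

/-- For `n ≥ 2`, the quotient ring `ℚ[ξ,α,ρ]/⟨P₁,P₂,P₃⟩` is a finite-dimensional
`ℚ`-vector space of dimension `(n−1)·n·(n+1)`. -/
theorem stmt4 (n : ℕ) (hn : 2 ≤ n) :
    FiniteDimensional ℚ
      (MvPolynomial (Fin 3) ℚ ⧸
        Ideal.span ({P1 n, P2 n, P3 n} : Set (MvPolynomial (Fin 3) ℚ))) ∧
    Module.finrank ℚ
      (MvPolynomial (Fin 3) ℚ ⧸
        Ideal.span ({P1 n, P2 n, P3 n} : Set (MvPolynomial (Fin 3) ℚ)))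
      = (n - 1) * n * (n + 1) := by
  obtain ⟨m, rfl⟩ := Nat.exists_eq_add_of_le' (show 1 ≤ n by omega)
  have h := len_main m (by omega)
  unfold len at h
  have hfl : IsFiniteLength ℚ (RR ⧸
      Ideal.span ({P1 (m + 1), P2 (m + 1), P3 (m + 1)} : Set RR)) := by
    rw [← Module.length_ne_top_iff, h]
    exact ENat.natCast_ne_top _
  have hfd : FiniteDimensional ℚ (RR ⧸
      Ideal.span ({P1 (m + 1), P2 (m + 1), P3 (m + 1)} : Set RR)) := by
    have := (isFiniteLength_iff_isNoetherian_isArtinian.1 hfl).1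
    infer_instance
  refine ⟨hfd, ?_⟩
  rw [Module.length_eq_finrank] at h
  rw [Nat.add_sub_cancel]
  exact_mod_cast h
end

section
/- For every integer n ≥ 1, the ideal of ℚ[ξ,α,ρ] generated by φ(u_n), φ(v_n), φ(w_n) equals the ideal generated by P₁, P₂, P₃, where φ : ℚ[b,t,k] → ℚ[ξ,α,ρ] is the ℚ-algebra homomorphism determined by φ(b) = ξ, φ(t) = 2(ξ+ρ), φ(k) = 4α² − (ξ+ρ)², and (u_m, v_m, w_m) is defined recursively by (u₁, v₁, w₁) = (b(2b−t), 2b−t, 2) and (u_{m+1}, v_{m+1}, w_{m+1}) = (b·u_m, u_m + k·w_m, v_m + t·w_m). -/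
open MvPolynomial

/-- The variable `b` of `ℚ[b,t,k]`. -/
noncomputable def bVar : MvPolynomial (Fin 3) ℚ := X 0
/-- The variable `t` of `ℚ[b,t,k]`. -/
noncomputable def tVar : MvPolynomial (Fin 3) ℚ := X 1
/-- The variable `k` of `ℚ[b,t,k]`. -/
noncomputable def kVar : MvPolynomial (Fin 3) ℚ := X 2

/-- The Behrend–O'Halloran recursion: `BO m = (u_{m+1}, v_{m+1}, w_{m+1})`, where
`(u₁,v₁,w₁) = (b(2b−t), 2b−t, 2)` and
`(u_{m+1}, v_{m+1}, w_{m+1}) = (b·u_m, u_m + k·w_m, v_m + t·w_m)`. -/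
noncomputable def BO :
    ℕ → MvPolynomial (Fin 3) ℚ × MvPolynomial (Fin 3) ℚ × MvPolynomial (Fin 3) ℚ
  | 0 => (bVar * (2 * bVar - tVar), 2 * bVar - tVar, 2)
  | m + 1 =>
      (bVar * (BO m).1, (BO m).1 + kVar * (BO m).2.2, (BO m).2.1 + tVar * (BO m).2.2)

/-- The `ℚ`-algebra homomorphism `φ : ℚ[b,t,k] → ℚ[ξ,α,ρ]` with
`φ(b) = ξ`, `φ(t) = 2(ξ+ρ)`, `φ(k) = 4α² − (ξ+ρ)²`. -/
noncomputable def phiBO : MvPolynomial (Fin 3) ℚ →ₐ[ℚ] MvPolynomial (Fin 3) ℚ :=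
  MvPolynomial.aeval ![xiVar, 2 * (xiVar + rhVar), 4 * alVar ^ 2 - (xiVar + rhVar) ^ 2]

/-- Single-root part of `P1`, defined by recursion. -/
noncomputable def aRec (x : MvPolynomial (Fin 3) ℚ) : ℕ → MvPolynomial (Fin 3) ℚ
  | 0 => 0
  | n + 1 => (x + xiVar) * aRec x n + xiVar ^ n

lemma aRec_mul (x : MvPolynomial (Fin 3) ℚ) (n : ℕ) :
    x * aRec x n = (x + xiVar) ^ n - xiVar ^ n := by
  induction n with
  | zero => simp [aRec]
  | succ n ih =>
    simp only [aRec]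
    linear_combination (x + xiVar) * ih

lemma sum_mul (x : MvPolynomial (Fin 3) ℚ) (n : ℕ) :
    x * (∑ k ∈ Finset.Icc 1 n, (n.choose k : MvPolynomial (Fin 3) ℚ) * xiVar ^ (n - k) *
      x ^ (k - 1)) = (x + xiVar) ^ n - xiVar ^ n := by
  rw [add_pow, Finset.sum_range_succ', Finset.mul_sum, Finset.range_eq_Ico,
    Finset.sum_Ico_add' (fun k => x ^ k * xiVar ^ (n - k) * (n.choose k : MvPolynomial (Fin 3) ℚ))
      0 n 1]
  simp only [pow_zero, Nat.sub_zero, Nat.choose_zero_right, Nat.cast_one, one_mul, mul_one,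
    add_sub_cancel_right, zero_add]
  have : Finset.Ico 1 (n + 1) = Finset.Icc 1 n := by ext; simp
  rw [this]
  refine Finset.sum_congr rfl fun k hk => ?_
  obtain ⟨j, rfl⟩ : ∃ j, k = j + 1 := ⟨k - 1, by simp at hk; omega⟩
  simp only [Nat.add_sub_cancel]
  ring

lemma sum_eq (x : MvPolynomial (Fin 3) ℚ) (hx : x ≠ 0) (n : ℕ) :
    (∑ k ∈ Finset.Icc 1 n, (n.choose k : MvPolynomial (Fin 3) ℚ) * xiVar ^ (n - k) *
      x ^ (k - 1)) = aRec x n :=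
  mul_left_cancel₀ hx ((sum_mul x n).trans (aRec_mul x n).symm)

lemma p_ne : rhVar + 2 * alVar ≠ 0 := by
  intro h
  have := congrArg (MvPolynomial.eval ![0, 0, (1 : ℚ)]) h
  simp [rhVar, alVar] at this

lemma q_ne : rhVar - 2 * alVar ≠ 0 := by
  intro h
  have := congrArg (MvPolynomial.eval ![0, 0, (1 : ℚ)]) h
  simp [rhVar, alVar] at this

lemma P1_eq (n : ℕ) : P1 n = aRec (rhVar + 2 * alVar) n + aRec (rhVar - 2 * alVar) n := by
  rw [← sum_eq _ p_ne, ← sum_eq _ q_ne, ← Finset.sum_add_distrib, P1]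
  exact Finset.sum_congr rfl fun k _ => by ring

lemma phi_b : phiBO bVar = xiVar := by simp [phiBO, bVar]
lemma phi_t : phiBO tVar = 2 * (xiVar + rhVar) := by simp [phiBO, tVar]
lemma phi_k : phiBO kVar = 4 * alVar ^ 2 - (xiVar + rhVar) ^ 2 := by simp [phiBO, kVar]

lemma BO_eq (m : ℕ) : phiBO (BO m).1 = -2 * P3 (m + 1) ∧
    phiBO (BO m).2.1 = P2 (m + 1) - (2 * rhVar + xiVar) * P1 (m + 1) ∧
    phiBO (BO m).2.2 = P1 (m + 1) := by
  induction m with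
  | zero =>
    simp only [BO, map_mul, map_sub, phi_b, phi_t, map_ofNat, P1_eq, aRec, P2, P3]
    refine ⟨by ring, by ring, by ring⟩
  | succ m ih =>
    obtain ⟨h1, h2, h3⟩ := ih
    have hp := aRec_mul (rhVar + 2 * alVar) (m + 1)
    have hq := aRec_mul (rhVar - 2 * alVar) (m + 1)
    have ep : aRec (rhVar + 2 * alVar) (m + 1 + 1) =
      (rhVar + 2 * alVar + xiVar) * aRec (rhVar + 2 * alVar) (m + 1) + xiVar ^ (m + 1) := rfl
    have eq : aRec (rhVar - 2 * alVar) (m + 1 + 1) =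
      (rhVar - 2 * alVar + xiVar) * aRec (rhVar - 2 * alVar) (m + 1) + xiVar ^ (m + 1) := rfl
    simp only [BO, map_mul, map_add, phi_b, phi_t, phi_k, h1, h2, h3]
    simp only [P1_eq, P2, P3, ep, eq]
    generalize aRec (rhVar + 2 * alVar) (m + 1) = a at *
    generalize aRec (rhVar - 2 * alVar) (m + 1) = b at *
    rw [pow_succ (rhVar + 2 * alVar + xiVar) (m + 1), pow_succ (rhVar - 2 * alVar + xiVar) (m + 1),
      pow_succ xiVar (m + 1)]
    generalize (rhVar + 2 * alVar + xiVar) ^ (m + 1) = c at *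
    generalize (rhVar - 2 * alVar + xiVar) ^ (m + 1) = d at *
    generalize xiVar ^ (m + 1) = e at *
    refine ⟨by ring, ?_, ?_⟩
    · linear_combination (rhVar + 2 * alVar + xiVar) * hp + (rhVar - 2 * alVar + xiVar) * hq
    · linear_combination -hp - hq

/-- For `n ≥ 1`, the ideal generated by the images under `φ` of the Behrend–O'Halloran
triple `(u_n, v_n, w_n)` equals the ideal `⟨P₁, P₂, P₃⟩` of Kiem–Moon, Theorem 1.3(1). -/
theorem stmt5 (n : ℕ) (hn : 1 ≤ n) :
    Ideal.span ({phiBO (BO (n - 1)).1, phiBO (BO (n - 1)).2.1, phiBO (BO (n - 1)).2.2} :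
        Set (MvPolynomial (Fin 3) ℚ))
      = Ideal.span ({P1 n, P2 n, P3 n} : Set (MvPolynomial (Fin 3) ℚ)) := by
  obtain ⟨m, rfl⟩ : ∃ m, n = m + 1 := ⟨n - 1, by omega⟩
  obtain ⟨h1, h2, h3⟩ := BO_eq m
  rw [Nat.add_sub_cancel, h1, h2, h3]
  have hC : (C (-1 / 2 : ℚ) : MvPolynomial (Fin 3) ℚ) * (-2) = 1 := by
    have : (-2 : MvPolynomial (Fin 3) ℚ) = C (-2 : ℚ) := by rw [C_neg, map_ofNat]
    rw [this, ← C_mul]; norm_num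
  generalize P1 (m + 1) = p1
  generalize P2 (m + 1) = p2
  generalize P3 (m + 1) = p3
  apply le_antisymm
  · rw [Ideal.span_le]
    have i1 : p1 ∈ Ideal.span {p1, p2, p3} := Ideal.subset_span (by simp)
    have i2 : p2 ∈ Ideal.span {p1, p2, p3} := Ideal.subset_span (by simp)
    have i3 : p3 ∈ Ideal.span {p1, p2, p3} := Ideal.subset_span (by simp)
    rintro x (rfl | rfl | rfl)
    · exact Ideal.mul_mem_left _ _ i3
    · exact Ideal.sub_mem _ i2 (Ideal.mul_mem_left _ _ i1)
    · exact i1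
  · rw [Ideal.span_le]
    set J := Ideal.span {-2 * p3, p2 - (2 * rhVar + xiVar) * p1, p1} with hJ
    have i1 : p1 ∈ J := Ideal.subset_span (by simp)
    have i2 : p2 - (2 * rhVar + xiVar) * p1 ∈ J := Ideal.subset_span (by simp)
    have i3 : -2 * p3 ∈ J := Ideal.subset_span (by simp)
    have j2 : p2 ∈ J := by
      have := Ideal.add_mem _ i2 (Ideal.mul_mem_left _ (2 * rhVar + xiVar) i1)
      rwa [sub_add_cancel] at this
    have j3 : p3 ∈ J := by
      have := Ideal.mul_mem_left _ (C (-1 / 2 : ℚ)) i3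
      rwa [← mul_assoc, hC, one_mul] at this
    intro x hx
    simp only [Set.mem_insert_iff, Set.mem_singleton_iff] at hx
    rcases hx with h | h | h <;> rw [h] <;> assumption
end
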